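/- Let A be a Banach algebra and φ ∈ Δ(A). If A is pseudo-amenable, then A is approximately left φ-biprojective. -/

import Mathlib

open Filter Topology

universe u

/-! ## Nets indexed by directed sets -/

/-- A (nonempty) directed index type, used to index nets. -/
structure DirSys : Type (u + 1) where
  ι : Type u
  [pre : Preorder ι]
  [dir : IsDirected ι (· ≤ ·)]
  [ne : Nonempty ι]

attribute [instance] DirSys.pre DirSys.dir DirSys.ne

section Core

variable (A : Type u) [NonUnitalNormedRing A] [NormedSpace ℂ A]
  [IsScalarTower ℂ A A] [SMulCommClass ℂ A A]

/-- A realization of the projective tensor product `A ⊗̂ A` of a Banach algebra `A` with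
itself, together with its canonical Banach `A`-bimodule structure and the product
(diagonal) map `π_A`.  The field `universal` is the universal property of the projective
tensor norm, which pins the object down uniquely up to isometric isomorphism. -/
structure ProjTensorSq (X : Type u) [NormedAddCommGroup X] [NormedSpace ℂ X]
    [CompleteSpace X] : Type (u + 1) where
  /-- the canonical bilinear map `(a, b) ↦ a ⊗ b` -/
  tmul : A →L[ℂ] A →L[ℂ] X
  /-- the projective norm is a cross norm -/
  norm_tmul : ∀ a b : A, ‖tmul a b‖ = ‖a‖ * ‖b‖
  /-- elementary tensors span a dense subspace -/
  dense_span : Dense (Submodule.span ℂ (Set.range fun p : A × A => tmul p.1 p.2) : Set X)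
  /-- the universal property of the projective tensor product -/
  universal : ∀ (Y : Type u) [NormedAddCommGroup Y] [NormedSpace ℂ Y] [CompleteSpace Y]
      (f : A →L[ℂ] A →L[ℂ] Y), ∃ g : X →L[ℂ] Y, ‖g‖ ≤ ‖f‖ ∧ ∀ a b : A, g (tmul a b) = f a b
  /-- the left module action `a · (b ⊗ c) = (a * b) ⊗ c` -/
  lsmul : A →L[ℂ] X →L[ℂ] X
  lsmul_tmul : ∀ a b c : A, lsmul a (tmul b c) = tmul (a * b) c
  /-- the right module action `(b ⊗ c) · a = b ⊗ (c * a)` -/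
  rsmul : A →L[ℂ] X →L[ℂ] X
  rsmul_tmul : ∀ a b c : A, rsmul a (tmul b c) = tmul b (c * a)
  /-- the product map `π_A`, determined by `π_A (a ⊗ b) = a * b` -/
  projL : X →L[ℂ] A
  projL_tmul : ∀ a b : A, projL (tmul a b) = a * b

variable {A}

/-- `A` is approximately left `φ`-biprojective:  there is a net `(ρ_α)` of bounded linear
maps `A → A ⊗̂ A` with `a·ρ_α(x) - ρ_α(ax) → 0`, `ρ_α(xa) - φ(a)ρ_α(x) → 0` and
`φ(π_A(ρ_α(x))) → φ(x)` for all `a x : A`. -/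
def ApproxLeftBiprojective (φ : WeakDual.characterSpace ℂ A) : Prop :=
  ∀ (X : Type u) [NormedAddCommGroup X] [NormedSpace ℂ X] [CompleteSpace X]
    (P : ProjTensorSq A X),
    ∃ (D : DirSys.{u}) (ρ : D.ι → (A →L[ℂ] X)),
      (∀ a x : A, Tendsto (fun i => P.lsmul a (ρ i x) - ρ i (a * x)) atTop (𝓝 0)) ∧
      (∀ a x : A, Tendsto (fun i => ρ i (x * a) - φ a • ρ i x) atTop (𝓝 0)) ∧
      (∀ x : A, Tendsto (fun i => φ (P.projL (ρ i x))) atTop (𝓝 (φ x)))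

/-- `A` is approximately left character biprojective if it is approximately left
`φ`-biprojective for every character `φ` of `A`. -/
def ApproxLeftCharBiprojective : Prop :=
  ∀ φ : WeakDual.characterSpace ℂ A, ApproxLeftBiprojective φ

/-- `A` is approximately left `φ`-amenable: there is a (not necessarily bounded) net
`(a_α)` in `A` with `‖a * a_α - φ(a) a_α‖ → 0` for every `a` and `φ(a_α) → 1`. -/
def ApproxLeftAmenable (φ : WeakDual.characterSpace ℂ A) : Prop :=
  ∃ (D : DirSys.{u}) (v : D.ι → A),
    (∀ a : A, Tendsto (fun i => a * v i - φ a • v i) atTop (𝓝 0)) ∧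
    Tendsto (fun i => φ (v i)) atTop (𝓝 1)

/-- `A` is approximately biprojective (Zhang): there is a net `(ρ_α)` of bounded
`A`-bimodule morphisms `A → A ⊗̂ A` with `π_A(ρ_α(a)) → a` for every `a`. -/
def ApproxBiprojective : Prop :=
  ∀ (X : Type u) [NormedAddCommGroup X] [NormedSpace ℂ X] [CompleteSpace X]
    (P : ProjTensorSq A X),
    ∃ (D : DirSys.{u}) (ρ : D.ι → (A →L[ℂ] X)),
      (∀ i, ∀ a b : A, ρ i (a * b) = P.lsmul a (ρ i b)) ∧
      (∀ i, ∀ a b : A, ρ i (a * b) = P.rsmul b (ρ i a)) ∧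
      (∀ a : A, Tendsto (fun i => P.projL (ρ i a)) atTop (𝓝 a))

/-- `A` is pseudo-amenable: there is a (not necessarily bounded) net `(m_α)` in `A ⊗̂ A`
with `a·m_α - m_α·a → 0` and `π_A(m_α) a → a` for every `a`. -/
def PseudoAmenable : Prop :=
  ∀ (X : Type u) [NormedAddCommGroup X] [NormedSpace ℂ X] [CompleteSpace X]
    (P : ProjTensorSq A X),
    ∃ (D : DirSys.{u}) (m : D.ι → X),
      (∀ a : A, Tendsto (fun i => P.lsmul a (m i) - P.rsmul a (m i)) atTop (𝓝 0)) ∧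
      (∀ a : A, Tendsto (fun i => P.projL (m i) * a - a) atTop (𝓝 0))

end Core

section

variable {A : Type u} [NonUnitalNormedRing A] [NormedSpace ℂ A]

namespace ProjTensorSq

variable {X : Type u} [NormedAddCommGroup X] [NormedSpace ℂ X] [CompleteSpace X]

/-- Bounded linear maps on `A ⊗̂ A` agreeing on elementary tensors are equal. -/
theorem clm_ext (P : ProjTensorSq A X) {Y : Type*} [NormedAddCommGroup Y] [NormedSpace ℂ Y]
    {S T : X →L[ℂ] Y} (h : ∀ a b : A, S (P.tmul a b) = T (P.tmul a b)) : S = T :=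
  ContinuousLinearMap.ext_on P.dense_span (by rintro _ ⟨p, rfl⟩; exact h p.1 p.2)

/-- The slice map `id ⊗ φ : A ⊗̂ A → A` of a character `φ`, with its module properties. -/
theorem exists_slice [IsScalarTower ℂ A A] [SMulCommClass ℂ A A] [CompleteSpace A]
    (P : ProjTensorSq A X)
    (φ : WeakDual.characterSpace ℂ A) :
    ∃ T : X →L[ℂ] A, (∀ a m, T (P.lsmul a m) = a * T m) ∧
      (∀ a m, T (P.rsmul a m) = φ a • T m) ∧ (∀ m, φ (T m) = φ (P.projL m)) := by
  let ψ : A →L[ℂ] ℂ := WeakDual.CharacterSpace.toCLM φ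
  have hψ : ∀ a, ψ a = φ a := fun _ => rfl
  obtain ⟨T, -, hT⟩ := P.universal A
    (((ContinuousLinearMap.lsmul ℂ ℂ : ℂ →L[ℂ] A →L[ℂ] A).comp ψ).flip)
  replace hT : ∀ a b, T (P.tmul a b) = φ b • a := hT
  refine ⟨T, fun a m => ?_, fun a m => ?_, fun m => ?_⟩
  · refine DFunLike.congr_fun (f := T.comp (P.lsmul a))
      (g := (ContinuousLinearMap.mul ℂ A a).comp T) (P.clm_ext fun b c => ?_) m
    simp [P.lsmul_tmul, hT]
  · refine DFunLike.congr_fun (f := T.comp (P.rsmul a)) (g := φ a • T)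
      (P.clm_ext fun b c => ?_) m
    simp [P.rsmul_tmul, hT, mul_comm, smul_smul]
  · refine DFunLike.congr_fun (f := ψ.comp T) (g := ψ.comp P.projL)
      (P.clm_ext fun b c => ?_) m
    simp [hψ, P.projL_tmul, hT, mul_comm]

end ProjTensorSq

end

theorem WeakDual.CharacterSpace.exists_apply_eq_one {A : Type*} [NonUnitalNormedRing A]
    [NormedSpace ℂ A] (φ : WeakDual.characterSpace ℂ A) :
    ∃ u : A, φ u = 1 := by
  obtain ⟨a, ha⟩ : ∃ a, φ a ≠ 0 := by
    by_contra! h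
    exact φ.2.1 (DFunLike.ext _ _ h)
  exact ⟨(φ a)⁻¹ • a, by rw [map_smul, smul_eq_mul, inv_mul_cancel₀ ha]⟩

/-- Remark 2.5, first half.  Let `A` be a Banach algebra and
`φ ∈ Δ(A)`.  If `A` is pseudo-amenable, then `A` is approximately left
`φ`-biprojective. -/
theorem pseudoAmenable_implies_approxLeftBiprojective
    {A : Type u} [NonUnitalNormedRing A] [NormedSpace ℂ A]
    [IsScalarTower ℂ A A] [SMulCommClass ℂ A A] [CompleteSpace A]
    (φ : WeakDual.characterSpace ℂ A)
    (hpa : PseudoAmenable (A := A)) :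
    ApproxLeftBiprojective φ := by
  intro X _ _ _ P
  obtain ⟨D, m, hm, hπ⟩ := hpa X P
  obtain ⟨T, hTl, hTr, hTπ⟩ := P.exists_slice φ
  obtain ⟨u, hu⟩ := WeakDual.CharacterSpace.exists_apply_eq_one φ
  let ψ : A →L[ℂ] ℂ := WeakDual.CharacterSpace.toCLM φ
  have hφ : Continuous φ := ψ.continuous
  have hv (a : A) : Tendsto (fun i => a * T (m i) - φ a • T (m i)) atTop (𝓝 0) := by
    simpa [Function.comp_def, hTl, hTr] using (T.continuous.tendsto 0).comp (hm a)
  have hφv : Tendsto (fun i => φ (T (m i))) atTop (𝓝 1) := by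
    have h := ((hφ.tendsto 0).comp (hπ u)).add_const 1
    simpa [Function.comp_def, hu, hTπ] using h
  have hρ (i : D.ι) (x : A) : ψ.smulRight (P.tmul (T (m i)) u) x = φ x • P.tmul (T (m i)) u := rfl
  refine ⟨D, fun i => ψ.smulRight (P.tmul (T (m i)) u), fun a x => ?_, fun a x => ?_, fun x => ?_⟩
  · have h := (((P.tmul.flip u).continuous.tendsto 0).comp (hv a)).const_smul (φ x)
    simp only [hρ]
    simpa [Function.comp_def, P.lsmul_tmul, smul_sub, smul_smul, mul_comm] using h
  · simp only [hρ, map_mul, smul_smul, mul_comm (φ a), sub_self]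
    exact tendsto_const_nhds
  · simp only [hρ, map_smul, P.projL_tmul, map_mul, hu, mul_one, smul_eq_mul]
    simpa using hφv.const_mul (φ x)
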